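/- arXiv:1704.03592 — 2 statements merged into one kernel-verified Lean document; each statement's English description precedes it below -/
import Mathlib

section
/- R(K_{3,5}, K_{1,6}) = 17. That is: (i) for every coloring of the edges of the complete graph on 17 vertices with 2 colors, either color 1 contains a subgraph isomorphic to the complete bipartite graph K_{3,5} or color 2 contains a subgraph isomorphic to the star K_{1,6}; and (ii) there exists a 2-coloring of the edges of the complete graph on 16 vertices with neither a K_{3,5} in color 1 nor a K_{1,6} in color 2. -/
/-- The coloring `c` of the edges of the complete graph on `Fin n` with `k` colors contains a
copy of `G` all of whose edges have color `i`. -/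
def HasMonoCopy {V : Type} {n k : ℕ} (G : SimpleGraph V)
    (c : Sym2 (Fin n) → Fin k) (i : Fin k) : Prop :=
  ∃ f : V → Fin n, Function.Injective f ∧ ∀ u v : V, G.Adj u v → c s(f u, f v) = i

open Finset

theorem upper_aux (c : Sym2 (Fin 17) → Fin 2) :
    HasMonoCopy (completeBipartiteGraph (Fin 3) (Fin 5)) c 0 ∨
      HasMonoCopy (completeBipartiteGraph (Fin 1) (Fin 6)) c 1 := by
  classical
  by_cases hs : ∃ v : Fin 17, 6 ≤ (univ.filter (fun x => x ≠ v ∧ c s(v, x) = 1)).card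
  · right
    obtain ⟨v, hv⟩ := hs
    obtain ⟨S, hS, hc⟩ := exists_subset_card_eq hv
    have e := S.equivFinOfCardEq hc
    have hm : ∀ i, ((e.symm i : Fin 17) ≠ v ∧ c s(v, (e.symm i : Fin 17)) = 1) := fun i => by
      simpa using hS (e.symm i).2
    refine ⟨Sum.elim (fun _ => v) (fun i => (e.symm i : Fin 17)), ?_, ?_⟩
    · refine Function.Injective.sumElim (fun a b _ => Subsingleton.elim a b)
        (Subtype.val_injective.comp e.symm.injective) (fun a b h => (hm b).1 h.symm)
    · rintro (u | u) (w | w) h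
      · simp at h
      · exact (hm w).2
      · have := (hm u).2
        rw [Sym2.eq_swap] at this
        exact this
      · simp at h
  · left
    push Not at hs
    set P : Fin 17 → Finset (Fin 17) := fun v => univ.filter (fun x => x ≠ v ∧ c s(v, x) = 0)
      with hP
    have hcard : ∀ v, 11 ≤ (P v).card := by
      intro v
      have h1 := hs v
      have h2 : (univ : Finset (Fin 17)) ⊆
          (P v ∪ univ.filter (fun x => x ≠ v ∧ c s(v, x) = 1)) ∪ {v} := by
        intro x _
        have : c s(v, x) = 0 ∨ c s(v, x) = 1 := by
          generalize c s(v, x) = t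
          fin_cases t <;> simp
        by_cases hx : x = v
        · simp [hx]
        · simp [hP, hx, this]
      have h3 := card_le_card h2
      have h4 := card_union_le (P v ∪ univ.filter (fun x => x ≠ v ∧ c s(v, x) = 1)) {v}
      have h5 := card_union_le (P v) (univ.filter (fun x => x ≠ v ∧ c s(v, x) = 1))
      simp only [card_univ, Fintype.card_fin, card_singleton] at h3 h4
      omega
    have hT : ∃ T ∈ powersetCard 3 (univ : Finset (Fin 17)),
        4 < (univ.filter (fun v => T ⊆ P v)).card := by
      by_contra! hno
      have h1 := sum_le_card_nsmul _ _ 4 hno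
      have h2 : ∑ T ∈ powersetCard 3 (univ : Finset (Fin 17)),
          (univ.filter (fun v => T ⊆ P v)).card = ∑ v : Fin 17, (P v).card.choose 3 := by
        simp_rw [card_filter]
        rw [sum_comm]
        refine sum_congr rfl fun v _ => ?_
        rw [← card_filter, ← card_powersetCard]
        congr 1
        ext T
        simp [mem_powersetCard, and_comm]
      have h3 : ∑ v : Fin 17, 165 ≤ ∑ v : Fin 17, (P v).card.choose 3 :=
        sum_le_sum fun v _ => Nat.choose_le_choose 3 (hcard v)
      rw [card_powersetCard] at h1
      have h4 : Nat.choose 17 3 = 680 := by decide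
      simp [h4] at h1 h3
      omega
    obtain ⟨T, hT, h5⟩ := hT
    obtain ⟨S, hS, hc⟩ := exists_subset_card_eq (Nat.succ_le_of_lt h5)
    have e := S.equivFinOfCardEq hc
    have e' := T.equivFinOfCardEq (mem_powersetCard.1 hT).2
    have hm : ∀ i j, ((e'.symm i : Fin 17) ≠ (e.symm j : Fin 17) ∧
        c s((e.symm j : Fin 17), (e'.symm i : Fin 17)) = 0) := fun i j => by
      have := hS (e.symm j).2
      rw [mem_filter] at this
      simpa [hP] using this.2 (e'.symm i).2
    refine ⟨Sum.elim (fun i => (e'.symm i : Fin 17)) (fun i => (e.symm i : Fin 17)), ?_, ?_⟩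
    · exact Function.Injective.sumElim (Subtype.val_injective.comp e'.symm.injective)
        (Subtype.val_injective.comp e.symm.injective) (fun a b h => (hm a b).1 h)
    · rintro (u | u) (w | w) h
      · simp at h
      · have := (hm u w).2
        rw [Sym2.eq_swap] at this
        exact this
      · exact (hm w u).2
      · simp at h

/-- The Clebsch graph coloring (with loops given color 1). -/
def clebschFun (x y : Fin 16) : Fin 2 :=
  if (x.val ^^^ y.val) ∈ [0, 1, 2, 4, 8, 15] then 1 else 0

def clebschCol : Sym2 (Fin 16) → Fin 2 :=
  Sym2.lift ⟨clebschFun, fun x y => by unfold clebschFun; rw [Nat.xor_comm]⟩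

def clebschNbr (x : Fin 16) : Finset (Fin 16) := univ.filter (fun y => clebschFun x y = 1)

theorem clebsch_card : ∀ x, (clebschNbr x).card = 6 := by decide +kernel

theorem clebsch_self : ∀ x, x ∈ clebschNbr x := by decide +kernel

theorem clebsch_inter : ∀ x y, x ≠ y → (clebschNbr x ∩ clebschNbr y).card = 2 := by
  decide +kernel

theorem lower_aux : ∃ c : Sym2 (Fin 16) → Fin 2,
      ¬ HasMonoCopy (completeBipartiteGraph (Fin 3) (Fin 5)) c 0 ∧
      ¬ HasMonoCopy (completeBipartiteGraph (Fin 1) (Fin 6)) c 1 := by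
  refine ⟨clebschCol, ?_, ?_⟩
  · rintro ⟨f, hf, h⟩
    have key : ∀ i j, f (Sum.inr j) ∉ clebschNbr (f (Sum.inl i)) := by
      intro i j hm
      have h1 : clebschFun (f (Sum.inl i)) (f (Sum.inr j)) = 0 := h (Sum.inl i) (Sum.inr j) (by simp)
      simp [clebschNbr, h1] at hm
    have hne : ∀ i j : Fin 3, i ≠ j → f (Sum.inl i) ≠ f (Sum.inl j) := fun i j hij he =>
      hij (Sum.inl_injective (hf he))
    set A := clebschNbr (f (Sum.inl 0)) with hA
    set B := clebschNbr (f (Sum.inl 1)) with hB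
    set C := clebschNbr (f (Sum.inl 2)) with hC
    have a1 : A.card = 6 := clebsch_card _
    have a2 : B.card = 6 := clebsch_card _
    have a3 : C.card = 6 := clebsch_card _
    have b1 : (A ∩ B).card = 2 := clebsch_inter _ _ (hne 0 1 (by decide))
    have b2 : (A ∩ C).card = 2 := clebsch_inter _ _ (hne 0 2 (by decide))
    have b3 : (B ∩ C).card = 2 := clebsch_inter _ _ (hne 1 2 (by decide))
    have c1 := card_union_add_card_inter A B
    have c2 := card_union_add_card_inter (A ∪ B) C
    rw [union_inter_distrib_right] at c2
    have c3 := card_union_le (A ∩ C) (B ∩ C)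
    set L := univ.image (fun j : Fin 5 => f (Sum.inr j)) with hL
    have d1 : L.card = 5 := by
      exact (card_image_of_injective univ (hf.comp Sum.inr_injective)).trans (by simp)
    have d2 : Disjoint (A ∪ B ∪ C) L := by
      rw [disjoint_right]
      intro x hx
      obtain ⟨j, -, rfl⟩ := mem_image.1 hx
      simp only [mem_union, not_or]
      exact ⟨⟨key 0 j, key 1 j⟩, key 2 j⟩
    have d3 := card_union_of_disjoint d2
    have d4 := card_le_univ ((A ∪ B ∪ C) ∪ L)
    simp only [Fintype.card_fin] at d4
    omega
  · rintro ⟨f, hf, h⟩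
    have hsub : univ.image f ⊆ clebschNbr (f (Sum.inl 0)) := by
      intro x hx
      obtain ⟨u, -, rfl⟩ := mem_image.1 hx
      rcases u with u | u
      · rw [Subsingleton.elim u 0]; exact clebsch_self _
      · have h1 : clebschFun (f (Sum.inl 0)) (f (Sum.inr u)) = 1 :=
          h (Sum.inl 0) (Sum.inr u) (by simp)
        simp [clebschNbr, h1]
    have := card_le_card hsub
    rw [clebsch_card, card_image_of_injective _ hf] at this
    simp at this

/-- `R(K_{3,5}, K_{1,6}) = 17`. -/
theorem ramsey_K35_K16 :
    (∀ c : Sym2 (Fin 17) → Fin 2,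
      HasMonoCopy (completeBipartiteGraph (Fin 3) (Fin 5)) c 0 ∨
      HasMonoCopy (completeBipartiteGraph (Fin 1) (Fin 6)) c 1) ∧
    (∃ c : Sym2 (Fin 16) → Fin 2,
      ¬ HasMonoCopy (completeBipartiteGraph (Fin 3) (Fin 5)) c 0 ∧
      ¬ HasMonoCopy (completeBipartiteGraph (Fin 1) (Fin 6)) c 1) :=
  ⟨upper_aux, lower_aux⟩
end

section
/- R(K_{2,2,2}, K_{2,2,2}) ≤ 32. That is: for every coloring of the edges of the complete graph on 32 vertices with 2 colors, some color class contains a subgraph isomorphic to the complete tripartite graph K_{2,2,2} (the octahedron). -/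
noncomputable section OctSection

namespace Oct

open Finset Classical

variable {V : Type} (G : SimpleGraph V)

/-- Neighbours of `v` inside `W`. -/
def nb (W : Finset V) (v : V) : Finset V := W.filter (fun y => G.Adj v y)

/-- Twice the number of edges inside `W`. -/
def EE (W : Finset V) : ℕ := ∑ v ∈ W, (nb G W v).card

/-- No 4-cycle inside `W`. -/
def C4F (W : Finset V) : Prop :=
  ∀ a ∈ W, ∀ b ∈ W, ∀ c ∈ W, ∀ d ∈ W, a ≠ c → G.Adj a b → G.Adj c b →
    G.Adj a d → G.Adj c d → b = d

/-- No octahedron in the complement inside `W`. -/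
def DSF (W : Finset V) : Prop :=
  ∀ a ∈ W, ∀ a' ∈ W, ∀ b ∈ W, ∀ b' ∈ W, ∀ c ∈ W, ∀ c' ∈ W,
    a ≠ a' → b ≠ b' → c ≠ c' →
    Gᶜ.Adj a b → Gᶜ.Adj a b' → Gᶜ.Adj a' b → Gᶜ.Adj a' b' →
    Gᶜ.Adj a c → Gᶜ.Adj a c' → Gᶜ.Adj a' c → Gᶜ.Adj a' c' →
    Gᶜ.Adj b c → Gᶜ.Adj b c' → Gᶜ.Adj b' c → Gᶜ.Adj b' c' → False

variable {G}

lemma mem_nb {W : Finset V} {v y : V} : y ∈ nb G W v ↔ y ∈ W ∧ G.Adj v y := by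
  simp [nb]

lemma C4F.mono {W W' : Finset V} (h : C4F G W) (hs : W' ⊆ W) : C4F G W' :=
  fun a ha b hb c hc d hd => h a (hs ha) b (hs hb) c (hs hc) d (hs hd)

lemma DSF.mono {W W' : Finset V} (h : DSF G W) (hs : W' ⊆ W) : DSF G W' :=
  fun a ha a' ha' b hb b' hb' c hc c' hc' =>
    h a (hs ha) a' (hs ha') b (hs hb) b' (hs hb') c (hs hc) c' (hs hc')

lemma EE_eq_card (W : Finset V) :
    EE G W = ((W ×ˢ W).filter (fun p => G.Adj p.1 p.2)).card := by
  simp only [EE, nb, card_filter, sum_product]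

lemma EE_even (W : Finset V) : Even (EE G W) := by
  rw [EE_eq_card]
  set S := (W ×ˢ W).filter (fun p => G.Adj p.1 p.2) with hS
  have hm : ∀ p : V × V, p ∈ S → (p.2, p.1) ∈ S := by
    intro p hp
    simp only [hS, mem_filter, mem_product] at hp ⊢
    exact ⟨⟨hp.1.2, hp.1.1⟩, hp.2.symm⟩
  let f : Function.End S := fun p => ⟨(p.1.2, p.1.1), hm p.1 p.2⟩
  have : Fact (Nat.Prime 2) := ⟨Nat.prime_two⟩
  have h2 : f ^ 2 ^ 1 = 1 := by
    funext p
    rfl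
  have h := Equiv.Perm.card_fixedPoints_modEq h2
  have h0 : Fintype.card (Function.fixedPoints f) = 0 := by
    rw [Fintype.card_eq_zero_iff]
    refine ⟨fun ⟨p, hp⟩ => ?_⟩
    have h1 : p.1.2 = p.1.1 := congrArg (fun q : S => q.1.1) hp
    have h3 := p.2
    simp only [hS, mem_filter] at h3
    exact h3.2.ne h1.symm
  have h' : S.card ≡ 0 [MOD 2] := by
    rw [h0] at h
    simpa using h
  exact even_iff_two_dvd.mpr (Nat.modEq_zero_iff_dvd.mp h')

lemma tri_dvd (W : Finset V) : 3 ∣ ∑ v ∈ W, EE G (nb G W v) := by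
  have e : ∑ v ∈ W, EE G (nb G W v) = ((W ×ˢ (W ×ˢ W)).filter
      (fun p => G.Adj p.1 p.2.1 ∧ G.Adj p.2.1 p.2.2 ∧ G.Adj p.2.2 p.1)).card := by
    rw [card_filter, sum_product]
    refine sum_congr rfl fun v hv => ?_
    rw [EE_eq_card, ← card_filter]
    congr 1
    ext p
    simp only [mem_filter, mem_product, mem_nb]
    constructor
    · rintro ⟨⟨⟨h1, h2⟩, h3, h4⟩, h5⟩
      exact ⟨⟨h1, h3⟩, h2, h5, h4.symm⟩
    · rintro ⟨⟨h1, h3⟩, h2, h5, h4⟩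
      exact ⟨⟨⟨h1, h2⟩, h3, h4.symm⟩, h5⟩
  rw [e]
  set S := (W ×ˢ (W ×ˢ W)).filter
      (fun p => G.Adj p.1 p.2.1 ∧ G.Adj p.2.1 p.2.2 ∧ G.Adj p.2.2 p.1) with hS
  have hm : ∀ p : V × V × V, p ∈ S → (p.2.1, p.2.2, p.1) ∈ S := by
    intro p hp
    simp only [hS, mem_filter, mem_product] at hp ⊢
    tauto
  let f : Function.End S := fun p => ⟨(p.1.2.1, p.1.2.2, p.1.1), hm p.1 p.2⟩
  have : Fact (Nat.Prime 3) := ⟨Nat.prime_three⟩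
  have h2 : f ^ 3 ^ 1 = 1 := by
    funext p
    rfl
  have h := Equiv.Perm.card_fixedPoints_modEq h2
  have h0 : Fintype.card (Function.fixedPoints f) = 0 := by
    rw [Fintype.card_eq_zero_iff]
    refine ⟨fun ⟨p, hp⟩ => ?_⟩
    have h1 : p.1.2.1 = p.1.1 := congrArg (fun q : S => q.1.1) hp
    have h3 := p.2
    simp only [hS, mem_filter] at h3
    exact h3.2.1.ne h1.symm
  have h' : S.card ≡ 0 [MOD 3] := by
    rw [h0] at h
    simpa using h
  exact Nat.modEq_zero_iff_dvd.mp h'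

/-- Inside a neighbourhood every vertex has at most one neighbour. -/
lemma nb_uniq {W : Finset V} (h4 : C4F G W) {v y z z' : V} (hv : v ∈ W) (hy : y ∈ W)
    (hne : y ≠ v) (hz : z ∈ nb G W v) (hz' : z' ∈ nb G W v) (h : G.Adj y z) (h' : G.Adj y z') :
    z = z' := by
  rw [mem_nb] at hz hz'
  exact h4 y hy z hz.1 v hv z' hz'.1 hne h hz.2 h' hz'.2

/-- The vertices of the neighbourhood of `v` isolated inside it. -/
def iso (G : SimpleGraph V) (W : Finset V) (v : V) : Finset V :=
  (nb G W v).filter (fun y => ∀ z ∈ nb G W v, ¬ G.Adj y z)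

lemma iso_card {W : Finset V} (h4 : C4F G W) {v : V} (hv : v ∈ W) :
    EE G (nb G W v) + (iso G W v).card = (nb G W v).card := by
  have : ∀ y ∈ nb G W v, (nb G (nb G W v) y).card +
      (if ∀ z ∈ nb G W v, ¬ G.Adj y z then 1 else 0) = 1 := by
    intro y hy
    have hle : (nb G (nb G W v) y).card ≤ 1 := by
      rw [card_le_one]
      intro a ha b hb
      rw [mem_nb] at ha hb
      have hy' := mem_nb.mp hy
      exact nb_uniq h4 hv hy'.1 hy'.2.ne' ha.1 hb.1 ha.2 hb.2
    split_ifs with hi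
    · have : nb G (nb G W v) y = ∅ := by
        ext z
        simp only [mem_nb, notMem_empty, iff_false]
        rintro ⟨h1, h2⟩
        exact hi z (mem_nb.mpr h1) h2
      simp [this]
    · push Not at hi
      obtain ⟨z, hz, hyz⟩ := hi
      have : 0 < (nb G (nb G W v) y).card := card_pos.mpr ⟨z, mem_nb.mpr ⟨hz, hyz⟩⟩
      omega
  have h := sum_congr rfl this
  rw [sum_add_distrib] at h
  rw [iso, card_filter, EE, h, sum_const, smul_eq_mul, mul_one]

lemma iso_of_odd {W : Finset V} (h4 : C4F G W) {v : V} (hv : v ∈ W)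
    (ho : Odd (nb G W v).card) : ∃ y, y ∈ iso G W v := by
  have h := iso_card h4 hv
  obtain ⟨k, hk⟩ := EE_even (G := G) (nb G W v)
  obtain ⟨l, hl⟩ := ho
  have : 0 < (iso G W v).card := by omega
  exact card_pos.mp this

/-- The sum of `d(u) - 1` over neighbours. -/
lemma path_bound {W : Finset V} (h4 : C4F G W) {v : V} (hv : v ∈ W) :
    ∑ u ∈ nb G W v, ((nb G W u).card - 1) + (nb G W v).card % 2 ≤ W.card - 1 := by
  have hd : ∀ x ∈ nb G W v, ∀ y ∈ nb G W v, x ≠ y →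
      Disjoint ((nb G W x).erase v) ((nb G W y).erase v) := by
    intro x hx y hy hxy
    rw [disjoint_left]
    intro z hz hz'
    simp only [mem_erase, mem_nb] at hz hz' hx hy
    exact hxy (h4 v hv x hx.1 z hz.2.1 y hy.1 (Ne.symm hz.1) hx.2 hz.2.2.symm hy.2 hz'.2.2.symm)
  have hc := card_biUnion hd
  have hc2 : ∑ u ∈ nb G W v, ((nb G W u).card - 1) =
      ∑ u ∈ nb G W v, ((nb G W u).erase v).card := by
    refine sum_congr rfl fun u hu => ?_
    rw [card_erase_of_mem]
    rw [mem_nb] at hu ⊢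
    exact ⟨hv, hu.2.symm⟩
  rw [hc2, ← hc]
  rcases Nat.mod_two_eq_zero_or_one (nb G W v).card with h0 | h1
  · rw [h0, add_zero, ← card_erase_of_mem hv]
    refine card_le_card ?_
    intro z hz
    simp only [mem_biUnion, mem_erase, mem_nb] at hz ⊢
    obtain ⟨u, hu, hz⟩ := hz
    exact ⟨hz.1, hz.2.1⟩
  · obtain ⟨y, hy⟩ := iso_of_odd h4 hv (Nat.odd_iff.mpr h1)
    simp only [iso, mem_filter] at hy
    have hyv := mem_nb.mp hy.1
    have hyW : y ∈ W.erase v := mem_erase.mpr ⟨hyv.2.ne', hyv.1⟩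
    have hle : ((nb G W v).biUnion fun u => (nb G W u).erase v).card ≤
        ((W.erase v).erase y).card := by
      refine card_le_card ?_
      intro z hz
      simp only [mem_biUnion, mem_erase, mem_nb] at hz ⊢
      obtain ⟨u, hu, hz⟩ := hz
      refine ⟨?_, hz.1, hz.2.1⟩
      rintro rfl
      exact hy.2 u (mem_nb.mpr hu) hz.2.2.symm
    rw [card_erase_of_mem hyW, card_erase_of_mem hv] at hle
    have : 0 < (W.erase v).card := card_pos.mpr ⟨y, hyW⟩
    rw [card_erase_of_mem hv] at this
    omega

lemma sum_swap (W : Finset V) (f : V → ℕ) :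
    ∑ v ∈ W, ∑ u ∈ nb G W v, f u = ∑ u ∈ W, (nb G W u).card * f u := by
  have : ∀ v ∈ W, ∑ u ∈ nb G W v, f u = ∑ u ∈ W, if G.Adj v u then f u else 0 := by
    intro v hv
    rw [nb, sum_filter]
  rw [sum_congr rfl this, sum_comm]
  refine sum_congr rfl fun u hu => ?_
  rw [← sum_filter, sum_const, smul_eq_mul]
  congr 2
  ext z
  simp [nb, G.adj_comm]

lemma base_bound {W : Finset V} (h4 : C4F G W) :
    5 * EE G W ≤ W.card * W.card + 7 * W.card := by
  have h1 := sum_le_sum (fun v hv => path_bound (G := G) h4 (v := v) hv)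
  rw [sum_add_distrib, sum_swap, sum_const, smul_eq_mul, ← sum_add_distrib] at h1
  have h2 : ∑ v ∈ W, 5 * (nb G W v).card ≤ ∑ v ∈ W, (((nb G W v).card * ((nb G W v).card - 1)
      + (nb G W v).card % 2) + 8) := by
    refine sum_le_sum fun v _ => ?_
    generalize (nb G W v).card = d
    rcases Nat.lt_or_ge d 5 with h | h
    · interval_cases d <;> simp
    · obtain ⟨e, rfl⟩ := Nat.exists_eq_add_of_le h
      have : 5 + e - 1 = 4 + e := by omega
      rw [this]
      have : (5 + e) * 5 ≤ (5 + e) * (4 + e) + 8 := by nlinarith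
      omega
  rw [sum_add_distrib, sum_const, smul_eq_mul, ← mul_sum] at h2
  have h3 : W.card * (W.card - 1) + W.card = W.card * W.card := by
    rcases W.card with _ | n
    · simp
    · simp; ring
  have h5 : EE G W = ∑ v ∈ W, (nb G W v).card := rfl
  rw [h5]
  omega

/-- Deleting a vertex. -/
lemma EE_erase {W : Finset V} {v : V} (hv : v ∈ W) :
    EE G W = EE G (W.erase v) + 2 * (nb G W v).card := by
  have h1 : ∀ u ∈ W.erase v, (nb G W u).card =
      (nb G (W.erase v) u).card + if G.Adj v u then 1 else 0 := by
    intro u hu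
    simp only [nb, card_filter]
    rw [← sum_erase_add _ _ hv, G.adj_comm u v]
  have h2 : ∑ u ∈ W.erase v, (if G.Adj v u then 1 else 0) = (nb G W v).card := by
    rw [nb, card_filter, ← sum_erase_add _ _ hv]
    simp
  unfold EE
  rw [← sum_erase_add _ _ hv, sum_congr rfl h1, sum_add_distrib, h2]
  ring

lemma pair_exists {S : Finset V}
    (hu : ∀ x ∈ S, ∀ y ∈ S, ∀ z ∈ S, G.Adj x y → G.Adj x z → y = z) (hc : 2 ≤ S.card) :
    ∃ a ∈ S, ∃ a' ∈ S, a ≠ a' ∧ ∀ x ∈ S, x ≠ a → x ≠ a' → Gᶜ.Adj a x ∧ Gᶜ.Adj a' x := by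
  by_cases he : ∃ a ∈ S, ∃ a' ∈ S, G.Adj a a'
  · obtain ⟨a, ha, a', ha', h⟩ := he
    refine ⟨a, ha, a', ha', h.ne, fun x hx h1 h2 => ?_⟩
    rw [SimpleGraph.compl_adj, SimpleGraph.compl_adj]
    refine ⟨⟨h1.symm, fun h3 => ?_⟩, ⟨h2.symm, fun h3 => ?_⟩⟩
    · exact h2 (hu a ha x hx a' ha' h3 h)
    · exact h1 (hu a' ha' x hx a ha h3 h.symm)
  · push Not at he
    obtain ⟨a, ha, a', ha', hne⟩ := one_lt_card.mp hc
    refine ⟨a, ha, a', ha', hne, fun x hx h1 h2 => ?_⟩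
    rw [SimpleGraph.compl_adj, SimpleGraph.compl_adj]
    exact ⟨⟨h1.symm, he a ha x hx⟩, ⟨h2.symm, he a' ha' x hx⟩⟩

lemma diss_le {W : Finset V} (hD : DSF G W) {S : Finset V} (hS : S ⊆ W)
    (hu : ∀ x ∈ S, ∀ y ∈ S, ∀ z ∈ S, G.Adj x y → G.Adj x z → y = z) : S.card ≤ 5 := by
  by_contra hcon
  have hc : 6 ≤ S.card := by omega
  obtain ⟨a, ha, a', ha', hna, hA⟩ := pair_exists hu (by omega)
  set S1 := (S.erase a).erase a' with hS1
  have m1 : ∀ x, x ∈ S1 → x ∈ S ∧ x ≠ a ∧ x ≠ a' := by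
    intro x hx
    simp only [hS1, mem_erase] at hx
    exact ⟨hx.2.2, hx.2.1, hx.1⟩
  have c1 : S1.card = S.card - 2 := by
    rw [hS1, card_erase_of_mem (mem_erase.mpr ⟨hna.symm, ha'⟩), card_erase_of_mem ha]
    omega
  obtain ⟨b, hb, b', hb', hnb, hB⟩ := pair_exists
    (fun x hx y hy z hz => hu x (m1 x hx).1 y (m1 y hy).1 z (m1 z hz).1) (by omega : 2 ≤ S1.card)
  set S2 := (S1.erase b).erase b' with hS2
  have m2 : ∀ x, x ∈ S2 → x ∈ S1 ∧ x ≠ b ∧ x ≠ b' := by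
    intro x hx
    simp only [hS2, mem_erase] at hx
    exact ⟨hx.2.2, hx.2.1, hx.1⟩
  have c2 : S2.card = S1.card - 2 := by
    rw [hS2, card_erase_of_mem (mem_erase.mpr ⟨hnb.symm, hb'⟩), card_erase_of_mem hb]
    omega
  obtain ⟨c, hc3, c', hc', hnc⟩ := one_lt_card.mp (by omega : 1 < S2.card)
  have A : ∀ x, x ∈ S1 → Gᶜ.Adj a x ∧ Gᶜ.Adj a' x := fun x hx =>
    hA x (m1 x hx).1 (m1 x hx).2.1 (m1 x hx).2.2
  have B : ∀ x, x ∈ S2 → Gᶜ.Adj b x ∧ Gᶜ.Adj b' x := fun x hx =>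
    hB x (m2 x hx).1 (m2 x hx).2.1 (m2 x hx).2.2
  have k1 := (m2 c hc3).1
  have k2 := (m2 c' hc').1
  exact hD a (hS ha) a' (hS ha') b (hS (m1 b hb).1) b' (hS (m1 b' hb').1) c (hS (m1 c k1).1)
    c' (hS (m1 c' k2).1) hna hnb hnc (A b hb).1 (A b' hb').1 (A b hb).2 (A b' hb').2
    (A c k1).1 (A c' k2).1 (A c k1).2 (A c' k2).2 (B c hc3).1 (B c' hc').1 (B c hc3).2 (B c' hc').2

/-- `w` hangs on the neighbour `y` of `v`, outside the neighbourhood of `v`. -/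
def Hang (G : SimpleGraph V) (W : Finset V) (v y w : V) : Prop :=
  w ∈ W ∧ G.Adj y w ∧ Gᶜ.Adj v w ∧ ∀ y' ∈ nb G W v, y' ≠ y → Gᶜ.Adj y' w

lemma hang_exists {W : Finset V} (h4 : C4F G W) {v y : V} (hv : v ∈ W)
    (h3 : 3 ≤ (nb G W y).card) (hy : y ∈ iso G W v) :
    ∃ w1 w2, w1 ≠ w2 ∧ Hang G W v y w1 ∧ Hang G W v y w2 := by
  have hy1 : y ∈ nb G W v := (mem_filter.mp hy).1
  have hy2 : ∀ z ∈ nb G W v, ¬ G.Adj y z := (mem_filter.mp hy).2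
  have hy3 := mem_nb.mp hy1
  have key : ∀ w ∈ (nb G W y).erase v, Hang G W v y w := by
    intro w hw
    simp only [mem_erase, mem_nb] at hw
    have hvw : ¬ G.Adj v w := fun h => hy2 w (mem_nb.mpr ⟨hw.2.1, h⟩) hw.2.2
    refine ⟨hw.2.1, hw.2.2, ?_, ?_⟩
    · rw [SimpleGraph.compl_adj]
      exact ⟨hw.1.symm, hvw⟩
    · intro y' hy' hne
      rw [SimpleGraph.compl_adj]
      refine ⟨?_, fun h => ?_⟩
      · rintro rfl
        exact hvw (mem_nb.mp hy').2
      · exact hne (nb_uniq h4 hv hw.2.1 hw.1 hy' hy1 h.symm hw.2.2.symm)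
  have hc : 1 < ((nb G W y).erase v).card := by
    rw [card_erase_of_mem (mem_nb.mpr ⟨hv, hy3.2.symm⟩)]
    omega
  obtain ⟨w1, h1, w2, h2, hne⟩ := one_lt_card.mp hc
  exact ⟨w1, w2, hne, key w1 h1, key w2 h2⟩

lemma deg_ne_five {W : Finset V} (h4 : C4F G W) (hD : DSF G W)
    (h3 : ∀ v ∈ W, 3 ≤ (nb G W v).card) {v : V} (hv : v ∈ W) : (nb G W v).card ≠ 5 := by
  intro h5
  obtain ⟨y, hy⟩ := iso_of_odd h4 hv (by rw [h5]; decide)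
  have hy1 : y ∈ nb G W v := (mem_filter.mp hy).1
  have hy2 : ∀ z ∈ nb G W v, ¬ G.Adj y z := (mem_filter.mp hy).2
  obtain ⟨w, -, -, ⟨hw, hyw, hvw, hh⟩, -⟩ := hang_exists h4 hv (h3 y (mem_nb.mp hy1).1) hy
  rw [SimpleGraph.compl_adj] at hvw
  have hwN : w ∉ nb G W v := fun h => hvw.2 (mem_nb.mp h).2
  have huN : ∀ a ∈ nb G W v, ∀ b ∈ nb G W v, ∀ c ∈ nb G W v, G.Adj a b → G.Adj a c → b = c := by
    intro a ha b hb c hc hab hac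
    exact nb_uniq h4 hv (mem_nb.mp ha).1 (mem_nb.mp ha).2.ne' hb hc hab hac
  have hwy : ∀ z ∈ nb G W v, G.Adj z w → z = y := by
    intro z hz hzw
    by_contra hne
    have := hh z hz hne
    rw [SimpleGraph.compl_adj] at this
    exact this.2 hzw
  have := diss_le hD (S := insert w (nb G W v)) (by
    intro z hz
    rcases mem_insert.mp hz with rfl | hz
    · exact hw
    · exact (mem_nb.mp hz).1) (by
    intro a ha b hb c hc hab hac
    rcases mem_insert.mp ha with rfl | ha' <;> rcases mem_insert.mp hb with rfl | hb' <;>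
      rcases mem_insert.mp hc with rfl | hc'
    · rfl
    · exact (hab.ne rfl).elim
    · exact (hac.ne rfl).elim
    · rw [hwy b hb' hab.symm, hwy c hc' hac.symm]
    · rfl
    · have := hwy a ha' hab
      subst this
      exact (hy2 c hc' hac).elim
    · have := hwy a ha' hac
      subst this
      exact (hy2 b hb' hab).elim
    · exact huN a ha' b hb' c hc' hab hac)
  rw [card_insert_of_notMem hwN, h5] at this
  omega

lemma deg_le_five {W : Finset V} (h4 : C4F G W) (hD : DSF G W) {v : V} (hv : v ∈ W) :
    (nb G W v).card ≤ 5 := by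
  refine diss_le hD (fun z hz => (mem_nb.mp hz).1) ?_
  intro a ha b hb c hc hab hac
  exact nb_uniq h4 hv (mem_nb.mp ha).1 (mem_nb.mp ha).2.ne' hb hc hab hac

/-- Vertices hanging on a common vertex: nothing else sees two of them. -/
lemma hang_uniq {W : Finset V} (h4 : C4F G W) {v y p w1 w2 : V} (hy : y ∈ nb G W v)
    (hp : p ∈ W) (hpy : p ≠ y) (h1 : Hang G W v y w1) (h2 : Hang G W v y w2)
    (a1 : G.Adj p w1) (a2 : G.Adj p w2) : w1 = w2 :=
  h4 p hp w1 h1.1 y (mem_nb.mp hy).1 w2 h2.1 hpy a1 h1.2.1 a2 h2.2.1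

lemma hang_ne {W : Finset V} {v y z p q : V} (hy : y ∈ nb G W v) (hyz : y ≠ z)
    (h1 : Hang G W v y p) (h2 : Hang G W v z q) : p ≠ q := by
  rintro rfl
  have := h2.2.2.2 y hy hyz
  rw [SimpleGraph.compl_adj] at this
  exact this.2 h1.2.1

lemma iso_adj {W : Finset V} {v y z : V} (hy : y ∈ iso G W v) (hz : z ∈ nb G W v)
    (hne : y ≠ z) : Gᶜ.Adj y z := by
  rw [SimpleGraph.compl_adj]
  exact ⟨hne, (mem_filter.mp hy).2 z hz⟩

lemma no_two_iso {W : Finset V} (h4 : C4F G W) (hD : DSF G W)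
    (h3 : ∀ v ∈ W, 3 ≤ (nb G W v).card) {v : V} (hv : v ∈ W) (hc : (nb G W v).card = 4) :
    (iso G W v).card ≤ 1 := by
  by_contra hcon
  obtain ⟨y, hy, z, hz, hyz⟩ := one_lt_card.mp (by omega : 1 < (iso G W v).card)
  have hy1 : y ∈ nb G W v := (mem_filter.mp hy).1
  have hz1 : z ∈ nb G W v := (mem_filter.mp hz).1
  have hcard : (((nb G W v).erase y).erase z).card = 2 := by
    rw [card_erase_of_mem (mem_erase.mpr ⟨hyz.symm, hz1⟩), card_erase_of_mem hy1, hc]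
  obtain ⟨a, ha, b, hb, hab⟩ := one_lt_card.mp (by omega : 1 < (((nb G W v).erase y).erase z).card)
  simp only [mem_erase] at ha hb
  obtain ⟨w, -, -, hw, -⟩ := hang_exists h4 hv (h3 y (mem_nb.mp hy1).1) hy
  obtain ⟨u1, u2, hu, hu1, hu2⟩ := hang_exists h4 hv (h3 z (mem_nb.mp hz1).1) hz
  have hwz : w ≠ z := by
    rintro rfl
    exact (mem_filter.mp hy).2 _ hz1 hw.2.1
  obtain ⟨u, huH, hwu⟩ : ∃ u, Hang G W v z u ∧ ¬ G.Adj w u := by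
    by_cases h : G.Adj w u1
    · refine ⟨u2, hu2, fun h' => hu (hang_uniq h4 hz1 hw.1 hwz hu1 hu2 h h')⟩
    · exact ⟨u1, hu1, h⟩
  refine hD a (mem_nb.mp ha.2.2).1 b (mem_nb.mp hb.2.2).1 y (mem_nb.mp hy1).1 w hw.1
    z (mem_nb.mp hz1).1 u huH.1 hab hw.2.1.ne huH.2.1.ne
    (iso_adj hy ha.2.2 ha.2.1.symm).symm (hw.2.2.2 a ha.2.2 ha.2.1)
    (iso_adj hy hb.2.2 hb.2.1.symm).symm (hw.2.2.2 b hb.2.2 hb.2.1)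
    (iso_adj hz ha.2.2 ha.1.symm).symm (huH.2.2.2 a ha.2.2 ha.1)
    (iso_adj hz hb.2.2 hb.1.symm).symm (huH.2.2.2 b hb.2.2 hb.1)
    (iso_adj hy hz1 hyz) (huH.2.2.2 y hy1 hyz) (hw.2.2.2 z hz1 hyz.symm).symm ?_
  rw [SimpleGraph.compl_adj]
  exact ⟨hang_ne hy1 hyz hw huH, hwu⟩

lemma comb {a11 a12 a21 a22 b11 b12 b21 b22 c11 c12 c21 c22 : Prop}
    (T111 : a11 ∨ b11 ∨ c11) (T112 : a11 ∨ b12 ∨ c12) (T121 : a12 ∨ b21 ∨ c11)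
    (T122 : a12 ∨ b22 ∨ c12) (T211 : a21 ∨ b11 ∨ c21) (T212 : a21 ∨ b12 ∨ c22)
    (T221 : a22 ∨ b21 ∨ c21) (T222 : a22 ∨ b22 ∨ c22)
    (A1 : a11 → a12 → False) (A2 : a21 → a22 → False) (A3 : a11 → a21 → False)
    (A4 : a12 → a22 → False)
    (B1 : b11 → b12 → False) (B2 : b21 → b22 → False) (B3 : b11 → b21 → False)
    (B4 : b12 → b22 → False)
    (C1 : c11 → c12 → False) (C2 : c21 → c22 → False) (C3 : c11 → c21 → False)
    (C4 : c12 → c22 → False) :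
    ((a11 ∧ a22) ∨ (a12 ∧ a21)) ∧ ((b11 ∧ b22) ∨ (b12 ∧ b21)) ∧
      ((c11 ∧ c22) ∨ (c12 ∧ c21)) := by
  grind

/-- Two hanging pairs perfectly matched, without inner edges: contradiction. -/
lemma pm_false {W : Finset V} (h4 : C4F G W) (hD : DSF G W) {v x y z : V} (hv : v ∈ W)
    (hx : x ∈ nb G W v) (hy : y ∈ nb G W v) (hz : z ∈ nb G W v)
    (hxy : x ≠ y) (hxz : x ≠ z) (hyz : y ≠ z)
    {x1 x2 y1 y2 : V} (nx : x1 ≠ x2) (ny : y1 ≠ y2)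
    (X1 : Hang G W v x x1) (X2 : Hang G W v x x2) (Y1 : Hang G W v y y1) (Y2 : Hang G W v y y2)
    (ix : ¬ G.Adj x1 x2) (iy : ¬ G.Adj y1 y2) (h1 : G.Adj x1 y1) (h2 : G.Adj x2 y2) : False := by
  have ne : ∀ {p q}, Hang G W v x p → Hang G W v y q → p ≠ q := fun hp hq =>
    hang_ne hx hxy hp hq
  have xy : ∀ {p}, Hang G W v x p → p ≠ y := by
    rintro p hp rfl
    have := hp.2.2.1
    rw [SimpleGraph.compl_adj] at this
    exact this.2 (mem_nb.mp hy).2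
  have e1 : ¬ G.Adj x1 y2 := fun h => ny (hang_uniq h4 hy X1.1 (xy X1) Y1 Y2 h1 h)
  have e2 : ¬ G.Adj x2 y1 := fun h => ny (hang_uniq h4 hy X2.1 (xy X2) Y1 Y2 h h2)
  refine hD v hv z (mem_nb.mp hz).1 x1 X1.1 y1 Y1.1 x2 X2.1 y2 Y2.1 (mem_nb.mp hz).2.ne
    h1.ne h2.ne X1.2.2.1 Y1.2.2.1 (X1.2.2.2 z hz hxz.symm) (Y1.2.2.2 z hz hyz.symm)
    X2.2.2.1 Y2.2.2.1 (X2.2.2.2 z hz hxz.symm) (Y2.2.2.2 z hz hyz.symm) ?_ ?_ ?_ ?_ <;>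
    rw [SimpleGraph.compl_adj]
  · exact ⟨nx, ix⟩
  · exact ⟨ne X1 Y2, e1⟩
  · exact ⟨(ne X2 Y1).symm, fun h => e2 h.symm⟩
  · exact ⟨ny, iy⟩

lemma pm_false' {W : Finset V} (h4 : C4F G W) (hD : DSF G W) {v x y z : V} (hv : v ∈ W)
    (hx : x ∈ nb G W v) (hy : y ∈ nb G W v) (hz : z ∈ nb G W v)
    (hxy : x ≠ y) (hxz : x ≠ z) (hyz : y ≠ z)
    {x1 x2 y1 y2 : V} (nx : x1 ≠ x2) (ny : y1 ≠ y2)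
    (X1 : Hang G W v x x1) (X2 : Hang G W v x x2) (Y1 : Hang G W v y y1) (Y2 : Hang G W v y y2)
    (ix : ¬ G.Adj x1 x2) (iy : ¬ G.Adj y1 y2)
    (h : (G.Adj x1 y1 ∧ G.Adj x2 y2) ∨ (G.Adj x1 y2 ∧ G.Adj x2 y1)) : False := by
  rcases h with h | h
  · exact pm_false h4 hD hv hx hy hz hxy hxz hyz nx ny X1 X2 Y1 Y2 ix iy h.1 h.2
  · exact pm_false h4 hD hv hx hy hz hxy hxz hyz nx ny.symm X1 X2 Y2 Y1 ix
      (fun h' => iy h'.symm) h.1 h.2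

/-- Perfectly matched pairs do not both have inner edges. -/
lemma inner_false {W : Finset V} (h4 : C4F G W) {v x y : V}
    (hx : x ∈ nb G W v) (hxy : x ≠ y) {x1 x2 y1 y2 : V}
    (X1 : Hang G W v x x1) (X2 : Hang G W v x x2) (Y1 : Hang G W v y y1) (Y2 : Hang G W v y y2)
    (ix : G.Adj x1 x2) (iy : G.Adj y1 y2)
    (h : (G.Adj x1 y1 ∧ G.Adj x2 y2) ∨ (G.Adj x1 y2 ∧ G.Adj x2 y1)) : False := by
  rcases h with h | h
  · exact hang_ne hx hxy X2 Y1 (h4 x1 X1.1 x2 X2.1 y2 Y2.1 y1 Y1.1 (hang_ne hx hxy X1 Y2) ix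
      h.2.symm h.1 iy.symm)
  · exact hang_ne hx hxy X2 Y2 (h4 x1 X1.1 x2 X2.1 y1 Y1.1 y2 Y2.1 (hang_ne hx hxy X1 Y1) ix
      h.2.symm h.1 iy)

lemma three_not_iso {W : Finset V} (h4 : C4F G W) (hD : DSF G W)
    (h3 : ∀ v ∈ W, 3 ≤ (nb G W v).card) {v : V} (hv : v ∈ W) :
    (iso G W v).card ≤ 2 := by
  by_contra hcon
  obtain ⟨x, hx, y, hy, z, hz, hxy, hxz, hyz⟩ :=
    two_lt_card.mp (by omega : 2 < (iso G W v).card)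
  have mx : x ∈ nb G W v := (mem_filter.mp hx).1
  have my : y ∈ nb G W v := (mem_filter.mp hy).1
  have mz : z ∈ nb G W v := (mem_filter.mp hz).1
  obtain ⟨x1, x2, nx, X1, X2⟩ := hang_exists h4 hv (h3 x (mem_nb.mp mx).1) hx
  obtain ⟨y1, y2, ny, Y1, Y2⟩ := hang_exists h4 hv (h3 y (mem_nb.mp my).1) hy
  obtain ⟨z1, z2, nz, Z1, Z2⟩ := hang_exists h4 hv (h3 z (mem_nb.mp mz).1) hz
  have T : ∀ p q r, Hang G W v x p → Hang G W v y q → Hang G W v z r →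
      G.Adj p q ∨ G.Adj q r ∨ G.Adj p r := by
    intro p q r P Q R
    by_contra hno
    push Not at hno
    refine hD x (mem_nb.mp mx).1 p P.1 y (mem_nb.mp my).1 q Q.1 z (mem_nb.mp mz).1 r R.1
      P.2.1.ne Q.2.1.ne R.2.1.ne (iso_adj hx my hxy) (Q.2.2.2 x mx hxy)
      (P.2.2.2 y my hxy.symm).symm ?_ (iso_adj hx mz hxz) (R.2.2.2 x mx hxz)
      (P.2.2.2 z mz hxz.symm).symm ?_ (iso_adj hy mz hyz) (R.2.2.2 y my hyz)
      (Q.2.2.2 z mz hyz.symm).symm ?_ <;> rw [SimpleGraph.compl_adj]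
    · exact ⟨hang_ne mx hxy P Q, hno.1⟩
    · exact ⟨hang_ne mx hxz P R, hno.2.2⟩
    · exact ⟨hang_ne my hyz Q R, hno.2.1⟩
  have hne : ∀ {s t p : V}, t ∈ nb G W v → Hang G W v s p → p ≠ t := by
    rintro s t p ht hp rfl
    have := hp.2.2.1
    rw [SimpleGraph.compl_adj] at this
    exact this.2 (mem_nb.mp ht).2
  have U : ∀ {s t p w1 w2 : V}, t ∈ nb G W v → Hang G W v s p → Hang G W v t w1 →
      Hang G W v t w2 → w1 ≠ w2 → G.Adj p w1 → G.Adj p w2 → False := by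
    intro s t p w1 w2 ht hp h1 h2 hw a1 a2
    exact hw (hang_uniq h4 ht hp.1 (hne ht hp) h1 h2 a1 a2)
  obtain ⟨hA, hB, hC⟩ := comb (T x1 y1 z1 X1 Y1 Z1) (T x1 y1 z2 X1 Y1 Z2) (T x1 y2 z1 X1 Y2 Z1)
    (T x1 y2 z2 X1 Y2 Z2) (T x2 y1 z1 X2 Y1 Z1) (T x2 y1 z2 X2 Y1 Z2) (T x2 y2 z1 X2 Y2 Z1)
    (T x2 y2 z2 X2 Y2 Z2)
    (U my X1 Y1 Y2 ny) (U my X2 Y1 Y2 ny) (fun a b => U mx Y1 X1 X2 nx a.symm b.symm)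
    (fun a b => U mx Y2 X1 X2 nx a.symm b.symm)
    (U mz Y1 Z1 Z2 nz) (U mz Y2 Z1 Z2 nz) (fun a b => U my Z1 Y1 Y2 ny a.symm b.symm)
    (fun a b => U my Z2 Y1 Y2 ny a.symm b.symm)
    (U mz X1 Z1 Z2 nz) (U mz X2 Z1 Z2 nz) (fun a b => U mx Z1 X1 X2 nx a.symm b.symm)
    (fun a b => U mx Z2 X1 X2 nx a.symm b.symm)
  by_cases ix : G.Adj x1 x2
  · have iy : ¬ G.Adj y1 y2 := fun h => inner_false h4 mx hxy X1 X2 Y1 Y2 ix h hA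
    have iz : ¬ G.Adj z1 z2 := fun h => inner_false h4 mx hxz X1 X2 Z1 Z2 ix h hC
    exact pm_false' h4 hD hv my mz mx hyz hxy.symm hxz.symm ny nz Y1 Y2 Z1 Z2 iy iz hB
  · by_cases iy : G.Adj y1 y2
    · have iz : ¬ G.Adj z1 z2 := fun h => inner_false h4 my hyz Y1 Y2 Z1 Z2 iy h hB
      exact pm_false' h4 hD hv mx mz my hxz hxy hyz.symm nx nz X1 X2 Z1 Z2 ix iz hC
    · exact pm_false' h4 hD hv mx my mz hxy hxz hyz nx ny X1 X2 Y1 Y2 ix iy hA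

lemma deg_struct {W : Finset V} (h4 : C4F G W) (hD : DSF G W)
    (h3 : ∀ v ∈ W, 3 ≤ (nb G W v).card) {v : V} (hv : v ∈ W) :
    (nb G W v).card ≤ 4 ∧ EE G (nb G W v) + 4 = 2 * (nb G W v).card := by
  have a := deg_le_five h4 hD hv
  have b := deg_ne_five h4 hD h3 hv
  have c := three_not_iso h4 hD h3 hv
  have d := no_two_iso h4 hD h3 hv
  have e := iso_card h4 hv
  obtain ⟨k, hk⟩ := EE_even (G := G) (nb G W v)
  have f := h3 v hv
  omega

/-- The bound for the number of edges. -/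
def ub : ℕ → ℕ
  | 0 => 0 | 1 => 0 | 2 => 1 | 3 => 3 | 4 => 4 | 5 => 6 | 6 => 7 | 7 => 9 | 8 => 11 | 9 => 13
  | 10 => 16 | 11 => 18 | 12 => 21 | 13 => 24 | 14 => 27 | (n + 15) => 2 * n + 30

lemma ub_large {n : ℕ} (h : 15 ≤ n) : ub n = 2 * n := by
  obtain ⟨k, rfl⟩ := Nat.exists_eq_add_of_le' h
  simp [ub]
  ring

theorem edge_bound : ∀ (n : ℕ) (W : Finset V), W.card = n → C4F G W → DSF G W →
    EE G W ≤ 2 * ub n := by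
  intro n
  induction n with
  | zero =>
    intro W hW h4 hD
    have := base_bound h4
    rw [hW] at this
    omega
  | succ m ih =>
    intro W hW h4 hD
    obtain ⟨k, hk⟩ := EE_even (G := G) W
    by_cases hm : m ≤ 6
    · have hb := base_bound h4
      rw [hW] at hb
      interval_cases m <;> simp only [ub] <;> omega
    have del : ∀ v ∈ W, EE G W ≤ 2 * ub m + 2 * (nb G W v).card := by
      intro v hv
      rw [EE_erase hv]
      have := ih (W.erase v) (by rw [card_erase_of_mem hv, hW]; rfl)
        (h4.mono (erase_subset _ _)) (hD.mono (erase_subset _ _))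
      omega
    by_cases h3 : ∀ v ∈ W, 3 ≤ (nb G W v).card
    · have hs := fun v hv => deg_struct h4 hD h3 (v := v) hv
      have hE : EE G W = ∑ v ∈ W, (nb G W v).card := rfl
      have hle : EE G W ≤ 4 * (m + 1) := by
        rw [hE, mul_comm, ← hW]
        refine sum_le_card_nsmul _ _ _ fun v hv => (hs v hv).1
      by_cases h15 : 15 ≤ m + 1
      · rw [ub_large h15]
        omega
      have hsum : ∑ v ∈ W, EE G (nb G W v) + 4 * (m + 1) = 2 * EE G W := by
        have := sum_congr rfl (fun v hv => (hs v hv).2)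
        rw [sum_add_distrib, ← mul_sum, sum_const, hW, smul_eq_mul] at this
        rw [hE]
        omega
      obtain ⟨t, ht⟩ := tri_dvd (G := G) W
      by_cases hex : ∃ v ∈ W, (nb G W v).card = 3
      · obtain ⟨v, hv, hv3⟩ := hex
        have h1 := del v hv
        have h7 : 7 ≤ m := by omega
        have h8 : m ≤ 13 := by omega
        interval_cases m <;> simp only [ub] at h1 ⊢ <;> omega
      · push Not at hex
        have h4' : ∀ v ∈ W, (nb G W v).card = 4 := fun v hv => by
          have := hs v hv
          have := h3 v hv
          have := hex v hv
          omega
        obtain ⟨v, hv⟩ := card_pos.mp (by omega : 0 < W.card)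
        have h1 := del v hv
        have h2 : EE G W = 4 * (m + 1) := by
          rw [hE, sum_congr rfl h4', sum_const, hW, smul_eq_mul, mul_comm]
        rw [h4' v hv] at h1
        have h7 : 7 ≤ m := by omega
        have h8 : m ≤ 13 := by omega
        interval_cases m <;> simp only [ub] at h1 ⊢ <;> omega
    · push Not at h3
      obtain ⟨v, hv, h2⟩ := h3
      have h1 := del v hv
      by_cases h15 : 15 ≤ m
      · rw [ub_large h15] at h1
        rw [ub_large (by omega)]
        omega
      have h7 : 7 ≤ m := by omega
      have h8 : m ≤ 14 := by omega
      interval_cases m <;> simp only [ub] at h1 ⊢ <;> omega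

/-- No octahedron in `H`. -/
def NoOct (H : SimpleGraph V) : Prop :=
  ∀ a a' b b' c c' : V, a ≠ a' → b ≠ b' → c ≠ c' →
    H.Adj a b → H.Adj a b' → H.Adj a' b → H.Adj a' b' →
    H.Adj a c → H.Adj a c' → H.Adj a' c → H.Adj a' c' →
    H.Adj b c → H.Adj b c' → H.Adj b' c → H.Adj b' c' → False

/-- Common neighbours. -/
def cn [Fintype V] (G : SimpleGraph V) (u v : V) : Finset V :=
  univ.filter (fun w => G.Adj u w ∧ G.Adj v w)

lemma mem_cn [Fintype V] {u v w : V} : w ∈ cn G u v ↔ G.Adj u w ∧ G.Adj v w := by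
  simp [cn]

lemma cn_bound [Fintype V] (h1 : NoOct G) (h2 : NoOct Gᶜ) {u v : V} (huv : u ≠ v) :
    EE G (cn G u v) ≤ 2 * ub (cn G u v).card := by
  refine edge_bound _ _ rfl ?_ ?_
  · intro a ha b hb c hc d hd hac hab hcb had hcd
    rw [mem_cn] at ha hb hc hd
    by_contra hbd
    exact h1 u v a c b d huv hac hbd ha.1 hc.1 ha.2 hc.2 hb.1 hd.1 hb.2 hd.2 hab had hcb hcd
  · intro a _ a' _ b _ b' _ c _ c' _
    exact h2 a a' b b' c c'

lemma double_count [Fintype V] :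
    ∑ x : V, ∑ y : V, (if G.Adj x y then (cn G x y).offDiag.card else 0) =
      ∑ u : V, ∑ v : V, (if u ≠ v then EE G (cn G u v) else 0) := by
  have L : ∀ x y : V, (if G.Adj x y then (cn G x y).offDiag.card else 0) =
      ∑ q : V × V, if (G.Adj x y ∧ (G.Adj x q.1 ∧ G.Adj y q.1) ∧ (G.Adj x q.2 ∧ G.Adj y q.2) ∧
        q.1 ≠ q.2) then 1 else 0 := by
    intro x y
    rw [← card_filter]
    split_ifs with h
    · congr 1
      ext q
      simp [mem_offDiag, mem_cn, h]
    · simp [h]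
  have R : ∀ u v : V, (if u ≠ v then EE G (cn G u v) else 0) =
      ∑ p : V × V, if (G.Adj p.1 p.2 ∧ (G.Adj p.1 u ∧ G.Adj p.2 u) ∧ (G.Adj p.1 v ∧ G.Adj p.2 v) ∧
        u ≠ v) then 1 else 0 := by
    intro u v
    rw [← card_filter]
    split_ifs with h
    · rw [EE_eq_card]
      congr 1
      ext p
      simp only [mem_filter, mem_product, mem_cn, mem_univ, true_and, G.adj_comm p.1 u,
        G.adj_comm p.2 u, G.adj_comm p.1 v, G.adj_comm p.2 v]
      tauto
    · simp [h]
  simp only [L, R]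
  have c1 : ∀ f : V → V → V × V → ℕ, ∑ x : V, ∑ y : V, ∑ q : V × V, f x y q =
      ∑ p : V × V, ∑ q : V × V, f p.1 p.2 q := by
    intro f
    rw [Fintype.sum_prod_type]
  rw [c1, c1, sum_comm]

/-- Ordered pairs of common neighbours of an edge. -/
def mm [Fintype V] (G : SimpleGraph V) (x y : V) : ℤ :=
  if G.Adj x y then ((cn G x y).card : ℤ) * ((cn G x y).card - 1) else 0

lemma half_bound [Fintype V] (h1 : NoOct G) (h2 : NoOct Gᶜ) :
    ∑ x : V, ∑ y : V, mm G x y ≤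
      ∑ u : V, ∑ v : V, (if u ≠ v then 2 * (ub (cn G u v).card : ℤ) else 0) := by
  have h := double_count (G := G)
  have hle : ∑ u : V, ∑ v : V, (if u ≠ v then EE G (cn G u v) else 0) ≤
      ∑ u : V, ∑ v : V, (if u ≠ v then 2 * ub (cn G u v).card else 0) := by
    refine sum_le_sum fun u _ => sum_le_sum fun v _ => ?_
    split_ifs with hh
    · exact cn_bound h1 h2 hh
    · exact le_rfl
  rw [← h] at hle
  have hz : ((∑ x : V, ∑ y : V, (if G.Adj x y then (cn G x y).offDiag.card else 0) : ℕ) : ℤ) ≤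
      ((∑ u : V, ∑ v : V, (if u ≠ v then 2 * ub (cn G u v).card else 0) : ℕ) : ℤ) := by
    exact_mod_cast hle
  have ho : ∀ x y : V, ((cn G x y).offDiag.card : ℤ) =
      ((cn G x y).card : ℤ) * ((cn G x y).card - 1) := by
    intro x y
    rw [offDiag_card, Nat.cast_sub (Nat.le_mul_self _)]
    push_cast
    ring
  push_cast at hz
  simpa only [mm, ho] using hz

/-- Degree. -/
def dg [Fintype V] (G : SimpleGraph V) (u : V) : ℤ := ∑ w : V, if G.Adj u w then 1 else 0

lemma cn_sum [Fintype V] (u v : V) : ((cn G u v).card : ℤ) =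
    ∑ w : V, (if G.Adj u w then 1 else 0) * (if G.Adj v w then 1 else 0) := by
  rw [cn, card_filter]
  push_cast
  refine sum_congr rfl fun w _ => ?_
  split_ifs <;> simp_all

lemma cn_compl_adj [Fintype V] {u v : V} (h : G.Adj u v) :
    ((cn Gᶜ u v).card : ℤ) + dg G u + dg G v = Fintype.card V + (cn G u v).card := by
  rw [cn_sum, cn_sum, dg, dg, ← sum_add_distrib, ← sum_add_distrib,
    show (Fintype.card V : ℤ) = ∑ w : V, (1 : ℤ) by simp, ← sum_add_distrib]
  refine sum_congr rfl fun w _ => ?_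
  simp only [SimpleGraph.compl_adj]
  by_cases h1 : G.Adj u w <;> by_cases h2 : G.Adj v w
  · simp [h1, h2]
  · simp [h1, h2]
  · simp [h1, h2]
  · have e1 : u ≠ w := by
      rintro rfl
      exact h2 h.symm
    have e2 : v ≠ w := by
      rintro rfl
      exact h1 h
    simp [h1, h2, e1, e2]

lemma cn_compl_nadj [Fintype V] {u v : V} (hne : u ≠ v) (h : ¬ G.Adj u v) :
    ((cn Gᶜ u v).card : ℤ) + dg G u + dg G v + 2 = Fintype.card V + (cn G u v).card := by
  have e1 : (1 : ℤ) = ∑ w : V, if u = w then 1 else 0 := by simp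
  have e2 : (1 : ℤ) = ∑ w : V, if v = w then 1 else 0 := by simp
  have e3 : (2 : ℤ) = ∑ w : V, ((if u = w then 1 else 0) + (if v = w then 1 else 0)) := by
    rw [sum_add_distrib, ← e1, ← e2]
    norm_num
  rw [cn_sum, cn_sum, dg, dg, e3, ← sum_add_distrib, ← sum_add_distrib, ← sum_add_distrib,
    show (Fintype.card V : ℤ) = ∑ w : V, (1 : ℤ) by simp, ← sum_add_distrib]
  refine sum_congr rfl fun w _ => ?_
  simp only [SimpleGraph.compl_adj]
  by_cases h1 : u = w
  · subst h1
    have h' : ¬ G.Adj v u := fun h' => h h'.symm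
    simp [h', hne.symm]
  · by_cases h2 : v = w
    · subst h2
      simp [h, hne]
    · by_cases h3 : G.Adj u w <;> by_cases h4 : G.Adj v w <;> simp [h1, h2, h3, h4]

/-- The pointwise numerical inequality. -/
lemma numeric_fin : ∀ s o : Fin 33, 40 * ((s : ℕ) : ℤ) - 34 * (((o : ℕ) : ℤ) - (s : ℕ) - 1) - 268
    - 2 * (((o : ℕ) : ℤ) - (s : ℕ) - 1) ^ 2 ≤
    8 * (((s : ℕ) : ℤ) * ((s : ℕ) - 1) - 2 * (ub s : ℤ) - 2 * (ub o : ℤ)) := by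
  decide +kernel

lemma numeric (s : ℕ) (hs : s < 33) (o : ℕ) (ho : o < 33) : 40 * (s : ℤ) - 34 * ((o : ℤ) - s - 1) - 268
    - 2 * ((o : ℤ) - s - 1) ^ 2 ≤
    8 * ((s : ℤ) * (s - 1) - 2 * (ub s : ℤ) - 2 * (ub o : ℤ)) :=
  numeric_fin ⟨s, hs⟩ ⟨o, ho⟩

/-- Indicator of adjacency. -/
def ad (G : SimpleGraph V) (u v : V) : ℤ := if G.Adj u v then 1 else 0

/-- The quadratic lower bound. -/
def FF [Fintype V] (G : SimpleGraph V) (u v : V) : ℤ :=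
  40 * ((cn G u v).card : ℤ) + 64 + 50 * (dg G u + dg G v) - 4 * (dg G u ^ 2 + dg G v ^ 2)
    + ad G u v * (108 * (dg G u + dg G v) - 3308)

lemma point [Fintype V] (hc : Fintype.card V = 32) {u v : V} (hne : u ≠ v) :
    FF G u v ≤ 8 * (mm G u v + mm Gᶜ u v -
      2 * (ub (cn G u v).card : ℤ) - 2 * (ub (cn Gᶜ u v).card : ℤ)) := by
  have b1 : (cn G u v).card < 33 := by
    have := card_le_univ (cn G u v)
    omega
  have b2 : (cn Gᶜ u v).card < 33 := by
    have := card_le_univ (cn Gᶜ u v)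
    omega
  by_cases h : G.Adj u v
  · have h' : ¬ Gᶜ.Adj u v := by simp [h]
    have e := cn_compl_adj h
    have n := numeric _ b1 _ b2
    rw [hc] at e
    have e' : ((cn Gᶜ u v).card : ℤ) = 32 + (cn G u v).card - dg G u - dg G v := by
      push_cast at e
      linarith
    unfold mm
    rw [if_pos h, if_neg h']
    unfold FF ad
    rw [if_pos h]
    have k : ((cn Gᶜ u v).card : ℤ) - (cn G u v).card - 1 = 31 - dg G u - dg G v := by
      linarith
    rw [k] at n
    nlinarith [sq_nonneg (dg G u - dg G v)]
  · have h' : Gᶜ.Adj u v := by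
      rw [SimpleGraph.compl_adj]
      exact ⟨hne, h⟩
    have e := cn_compl_nadj hne h
    have n := numeric _ b2 _ b1
    rw [hc] at e
    have e' : ((cn Gᶜ u v).card : ℤ) = 30 + (cn G u v).card - dg G u - dg G v := by
      push_cast at e
      linarith
    unfold mm
    rw [if_neg h, if_pos h']
    unfold FF ad
    rw [if_neg h]
    have k : ((cn G u v).card : ℤ) - (cn Gᶜ u v).card - 1 = dg G u + dg G v - 31 := by
      linarith
    rw [k] at n
    nlinarith [sq_nonneg (dg G u - dg G v)]

lemma ad_sum [Fintype V] (u : V) : ∑ v : V, ad G u v = dg G u := rfl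

lemma ad_comm (u v : V) : ad G u v = ad G v u := by
  simp [ad, G.adj_comm]

lemma cn_total [Fintype V] :
    ∑ u : V, ∑ v : V, ((cn G u v).card : ℤ) = ∑ w : V, dg G w ^ 2 := by
  have h : ∀ u v : V, ((cn G u v).card : ℤ) = ∑ w : V, ad G w u * ad G w v := by
    intro u v
    rw [cn_sum]
    refine sum_congr rfl fun w _ => ?_
    rw [ad_comm w u, ad_comm w v]
    rfl
  simp only [h]
  have h2 : ∀ u : V, ∑ v : V, ∑ w : V, ad G w u * ad G w v = ∑ w : V, ad G w u * dg G w := by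
    intro u
    rw [sum_comm]
    refine sum_congr rfl fun w _ => ?_
    rw [← mul_sum, ad_sum]
  simp only [h2]
  rw [sum_comm]
  refine sum_congr rfl fun w _ => ?_
  rw [← sum_mul, ad_sum]
  ring

lemma FF_total [Fintype V] (hc : Fintype.card V = 32) :
    ∑ u : V, ∑ v : V, FF G u v = 65536 - 108 * ∑ u : V, dg G u := by
  set A := ∑ u : V, dg G u with hA
  set B := ∑ u : V, dg G u ^ 2 with hB
  have h1 : ∑ u : V, ∑ v : V, ad G u v = A := rfl
  have h2 : ∑ u : V, ∑ v : V, ad G u v * dg G u = B := by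
    rw [hB]
    refine sum_congr rfl fun u _ => ?_
    rw [← sum_mul, ad_sum]
    ring
  have h3 : ∑ u : V, ∑ v : V, ad G u v * dg G v = B := by
    rw [sum_comm, ← h2]
    refine sum_congr rfl fun u _ => sum_congr rfl fun v _ => ?_
    rw [ad_comm]
  have h4 : ∑ u : V, ∑ v : V, dg G u = 32 * A := by
    simp [hc, hA, mul_sum]
  have h5 : ∑ u : V, ∑ v : V, dg G v = 32 * A := by
    simp [hc, hA]
  have h6 : ∑ u : V, ∑ v : V, dg G u ^ 2 = 32 * B := by
    simp [hc, hB, mul_sum]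
  have h7 : ∑ u : V, ∑ v : V, dg G v ^ 2 = 32 * B := by
    simp [hc, hB]
  have h8 : ∑ u : V, ∑ v : V, (64 : ℤ) = 65536 := by
    simp [hc]
  have h9 := cn_total (G := G)
  have e : ∀ u v : V, FF G u v = 40 * ((cn G u v).card : ℤ) + 64 + 50 * dg G u + 50 * dg G v
      + (-4) * dg G u ^ 2 + (-4) * dg G v ^ 2 + 108 * (ad G u v * dg G u)
      + 108 * (ad G u v * dg G v) + (-3308) * ad G u v := by
    intro u v
    unfold FF
    ring
  simp only [e, sum_add_distrib, ← mul_sum]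
  rw [h1, h2, h3, h4, h5, h6, h7, h8, h9]
  ring

lemma FF_diag [Fintype V] (u : V) : FF G u u = 64 + 140 * dg G u - 8 * dg G u ^ 2 := by
  have h : ((cn G u u).card : ℤ) = dg G u := by
    rw [cn_sum, dg]
    refine sum_congr rfl fun w _ => ?_
    split_ifs <;> simp
  unfold FF ad
  rw [h]
  simp
  ring

lemma FF_pos [Fintype V] (hc : Fintype.card V = 32) :
    0 < ∑ u : V, ∑ v : V, (if u ≠ v then FF G u v else 0) := by
  have h : ∀ u : V, ∑ v : V, (if u ≠ v then FF G u v else 0) = ∑ v : V, FF G u v - FF G u u := by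
    intro u
    have : ∀ v : V, (if u ≠ v then FF G u v else 0) =
        FF G u v - (if u = v then FF G u v else 0) := by
      intro v
      split_ifs <;> simp_all
    simp only [this, sum_sub_distrib]
    simp
  simp only [h, sum_sub_distrib]
  rw [FF_total hc]
  have e : (65536 : ℤ) - 108 * ∑ u : V, dg G u - ∑ u : V, FF G u u =
      ∑ u : V, (8 * dg G u ^ 2 - 248 * dg G u + 1984) := by
    have : (65536 : ℤ) = ∑ u : V, 2048 := by simp [hc]
    rw [this, mul_sum, ← sum_sub_distrib, ← sum_sub_distrib]
    refine sum_congr rfl fun u _ => ?_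
    rw [FF_diag]
    ring
  rw [e]
  have : Nonempty V := by
    rw [← Fintype.card_pos_iff]
    omega
  refine sum_pos (fun u _ => ?_) univ_nonempty
  nlinarith [sq_nonneg (2 * dg G u - 31)]

theorem main [Fintype V] (hc : Fintype.card V = 32) (h1 : NoOct G) (h2 : NoOct Gᶜ) : False := by
  have a := half_bound h1 h2
  have b := half_bound h2 (by rwa [compl_compl])
  have p := FF_pos (G := G) hc
  have hle : ∑ u : V, ∑ v : V, (if u ≠ v then FF G u v else 0) ≤
      ∑ u : V, ∑ v : V, (8 * (mm G u v + mm Gᶜ u v -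
      (if u ≠ v then 2 * (ub (cn G u v).card : ℤ) else 0) -
      (if u ≠ v then 2 * (ub (cn Gᶜ u v).card : ℤ) else 0))) := by
    refine sum_le_sum fun u _ => sum_le_sum fun v _ => ?_
    by_cases huv : u = v
    · subst huv
      simp [mm]
    · rw [if_pos huv, if_pos huv, if_pos huv]
      exact point hc huv
  simp only [← mul_sum, sum_sub_distrib, sum_add_distrib] at hle
  linarith

lemma oct_copy {n k : ℕ} (c : Sym2 (Fin n) → Fin k) (i : Fin k) (H : SimpleGraph (Fin n))
    (hH : ∀ u v, H.Adj u v → c s(u, v) = i)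
    (hno : ¬ HasMonoCopy (SimpleGraph.completeMultipartiteGraph fun _ : Fin 3 => Fin 2) c i) :
    NoOct H := by
  intro a a' b b' d d' ha hb hd h1 h2 h3 h4 h5 h6 h7 h8 h9 h10 h11 h12
  apply hno
  have key : ∀ u v : (Σ _ : Fin 3, Fin 2), u.1 ≠ v.1 →
      H.Adj (![![a, a'], ![b, b'], ![d, d']] u.1 u.2) (![![a, a'], ![b, b'], ![d, d']] v.1 v.2) := by
    rintro ⟨x, y⟩ ⟨z, w⟩ h
    fin_cases x <;> fin_cases z <;> fin_cases y <;> fin_cases w <;>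
      first
        | exact absurd rfl h
        | assumption
        | (apply SimpleGraph.Adj.symm; assumption)
  refine ⟨fun u => ![![a, a'], ![b, b'], ![d, d']] u.1 u.2, ?_, ?_⟩
  · rintro ⟨x, y⟩ ⟨z, w⟩ h
    by_cases hxz : x = z
    · subst hxz
      fin_cases x <;> fin_cases y <;> fin_cases w <;>
        first
          | rfl
          | exact absurd h ha
          | exact absurd h hb
          | exact absurd h hd
          | exact absurd h.symm ha
          | exact absurd h.symm hb
          | exact absurd h.symm hd
    · exact absurd h (key ⟨x, y⟩ ⟨z, w⟩ hxz).ne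
  · intro u v h
    exact hH _ _ (key u v h)

end Oct

end OctSection

/-- `R(K_{2,2,2}, K_{2,2,2}) ≤ 32`, where `K_{2,2,2}` is the complete tripartite graph
with three parts of size 2 (the octahedron). -/
theorem ramsey_K222_K222_le :
    ∀ c : Sym2 (Fin 32) → Fin 2,
      ∃ i : Fin 2,
        HasMonoCopy (SimpleGraph.completeMultipartiteGraph fun _ : Fin 3 => Fin 2) c i := by
  intro c
  by_contra hcon
  rw [not_exists] at hcon
  let G : SimpleGraph (Fin 32) :=
    { Adj := fun u v => u ≠ v ∧ c s(u, v) = 0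
      symm := ⟨fun u v h => ⟨h.1.symm, by rw [Sym2.eq_swap]; exact h.2⟩⟩
      loopless := ⟨fun u h => h.1 rfl⟩ }
  have h1 : Oct.NoOct G := Oct.oct_copy c 0 G (fun u v h => h.2) (hcon 0)
  have h2 : Oct.NoOct Gᶜ := by
    refine Oct.oct_copy c 1 Gᶜ (fun u v h => ?_) (hcon 1)
    rw [SimpleGraph.compl_adj] at h
    have h0 : c s(u, v) ≠ 0 := fun h0 => h.2 ⟨h.1, h0⟩
    revert h0
    generalize c s(u, v) = t
    revert t
    decide
  exact Oct.main (by simp) h1 h2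
end
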